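/- arXiv:2407.21785 — 2 statements merged into one kernel-verified Lean document; each statement's English description precedes it below -/
import Mathlib

section
/- Let G = (S, V, E, π, σ, α) be a restaking graph that is secure with γ-slack for some γ > 0, i.e., for every attacking coalition (A, B) on G, (1+γ)·π_A ≤ σ_B. Then for every ψ > 0, the worst-case stake loss satisfies R_ψ(G) < (1 + 1/γ)·ψ. -/
/-- A restaking graph `G = (S, V, E, π, σ, α)`. -/
structure RestakingGraph where
  /-- services -/
  S : Type
  /-- validators -/
  V : Type
  finS : Fintype S
  finV : Fintype V
  /-- edge relation: `E s v` means validator `v` restakes for service `s` -/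
  E : S → V → Prop
  /-- profit from corruption -/
  pi : S → ℝ
  /-- stake -/
  stake : V → ℝ
  /-- attack thresholds -/
  alpha : S → ℝ
  pi_nonneg : ∀ s, 0 ≤ pi s
  stake_nonneg : ∀ v, 0 ≤ stake v
  alpha_pos : ∀ s, 0 < alpha s
  alpha_le_one : ∀ s, alpha s ≤ 1

attribute [instance] RestakingGraph.finS RestakingGraph.finV

namespace RestakingGraph

variable (G : RestakingGraph)

/-- `π_A = Σ_{s ∈ A} π_s` -/
noncomputable def piSum (A : Set G.S) : ℝ := ∑ᶠ s ∈ A, G.pi s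

/-- `σ_B = Σ_{v ∈ B} σ_v` -/
noncomputable def stakeSum (B : Set G.V) : ℝ := ∑ᶠ v ∈ B, G.stake v

/-- `N(s)`: validators adjacent to service `s` -/
def Ns (s : G.S) : Set G.V := {v | G.E s v}

/-- `N(v)`: services adjacent to validator `v` -/
def Nv (v : G.V) : Set G.S := {s | G.E s v}

/-- `N(A)`: validators adjacent to some service of `A` -/
def NA (A : Set G.S) : Set G.V := ⋃ s ∈ A, G.Ns s

/-- `N(C)`: validators adjacent to some service of `C` -/
def NC (C : Set G.S) : Set G.V := ⋃ s ∈ C, G.Ns s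

/-- `Γ(C)`: validators exclusive to `C` -/
def Gamma (C : Set G.S) : Set G.V := {v | G.Nv v ⊆ C}

/-- total stake `σ_V` -/
noncomputable def totalStake : ℝ := G.stakeSum Set.univ

/-- `(A, B)` is an attacking coalition on `G ↘ D` (for `D = ∅`, on `G` itself):
the remaining validators `B` control an `α_s` fraction of the remaining stake of
each `s ∈ A`. -/
def IsCoalition (D : Set G.V) (A : Set G.S) (B : Set G.V) : Prop :=
  Disjoint B D ∧ ∀ s ∈ A, G.alpha s * G.stakeSum (G.Ns s \ D) ≤ G.stakeSum (B ∩ G.Ns s)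

/-- `(A, B)` is a valid attack on `G ↘ D`. -/
def IsValidAttack (D : Set G.V) (A : Set G.S) (B : Set G.V) : Prop :=
  G.IsCoalition D A B ∧ G.stakeSum B < G.piSum A

/-- `(A, B)` is a stable attack on `G ↘ D`. -/
def IsStableAttack (D : Set G.V) (A : Set G.S) (B : Set G.V) : Prop :=
  G.IsValidAttack D A B ∧
    ∀ A' B', A' ⊆ A → B' ⊆ B → G.IsValidAttack D A' B' →
      G.stakeSum (B \ B') < G.piSum (A \ A')

/-- `B_1 ∪ ⋯ ∪ B_{t-1}`: the validators removed before step `t`. -/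
def prevUnion {T : ℕ} (B : Fin T → Set G.V) (t : Fin T) : Set G.V :=
  ⋃ i : Fin T, ⋃ _ : i < t, B i

/-- `(A_1, B_1), …, (A_T, B_T)` is a valid cascade of attacks on `G ↘ D`. -/
def IsCascade (D : Set G.V) {T : ℕ} (A : Fin T → Set G.S) (B : Fin T → Set G.V) : Prop :=
  (∀ i j, i ≠ j → Disjoint (A i) (A j)) ∧
  (∀ i j, i ≠ j → Disjoint (B i) (B j)) ∧
  ∀ t, G.IsValidAttack (D ∪ G.prevUnion B t) (A t) (B t)

/-- `(A_1, B_1), …, (A_T, B_T)` is a cascade of stable attacks on `G ↘ D`. -/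
def IsStableCascade (D : Set G.V) {T : ℕ} (A : Fin T → Set G.S) (B : Fin T → Set G.V) : Prop :=
  (∀ i j, i ≠ j → Disjoint (A i) (A j)) ∧
  (∀ i j, i ≠ j → Disjoint (B i) (B j)) ∧
  ∀ t, G.IsStableAttack (D ∪ G.prevUnion B t) (A t) (B t)

/-- `R_ψ(G)`: worst-case stake loss from a shock of relative size at most `ψ`
followed by an arbitrary valid cascade of attacks. -/
noncomputable def R (ψ : ℝ) : ℝ :=
  ψ + sSup { r : ℝ |
    ∃ (D : Set G.V) (T : ℕ) (A : Fin T → Set G.S) (B : Fin T → Set G.V),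
      G.stakeSum D / G.totalStake ≤ ψ ∧ G.IsCascade D A B ∧
      r = G.stakeSum (⋃ t, B t) / G.totalStake }

/-- `R_ψ(C, G)`: local worst-case stake loss (under stable attacks) for the
coalition of services `C`. -/
noncomputable def Rloc (C : Set G.S) (ψ : ℝ) : ℝ :=
  ψ + sSup { r : ℝ |
    ∃ (D : Set G.V) (T : ℕ) (A : Fin T → Set G.S) (B : Fin T → Set G.V),
      G.stakeSum (D ∩ G.Gamma C) / G.stakeSum (G.Gamma C) ≤ ψ ∧ G.IsStableCascade D A B ∧
      r = G.stakeSum ((⋃ t, B t) ∩ G.Gamma C) / G.stakeSum (G.Gamma C) }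

/-- `G` is secure: no valid attack exists. -/
def Secure : Prop := ∀ A B, ¬ G.IsValidAttack ∅ A B

/-- `G` is secure with `γ`-slack. -/
def SecureWithSlack (γ : ℝ) : Prop :=
  ∀ A B, G.IsCoalition ∅ A B → (1 + γ) * G.piSum A ≤ G.stakeSum B

/-- `(X, Y)` is an attack header on `G`. -/
def IsAttackHeader (X : Set G.S) (Y : Set G.V) : Prop :=
  Y ⊆ G.Gamma X ∧ ∃ B : Set G.V, B ∩ G.Gamma X = ∅ ∧ G.IsCoalition ∅ X (B ∪ Y)

/-- The EigenLayer sufficient condition. -/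
def EigenLayerCond : Prop :=
  ∀ v : G.V,
    (∑ᶠ s ∈ G.Nv v, G.stake v / G.stakeSum (G.Ns s) * (G.pi s / G.alpha s)) ≤ G.stake v

/-- The `γ`-scaled EigenLayer condition. -/
def EigenLayerSlackCond (γ : ℝ) : Prop :=
  ∀ v : G.V,
    (∑ᶠ s ∈ G.Nv v, G.stake v / G.stakeSum (G.Ns s) * ((1 + γ) * G.pi s / G.alpha s))
      ≤ G.stake v

end RestakingGraph

namespace RestakingGraph

theorem stakeSum_mono (G : RestakingGraph) {X Y : Set G.V} (h : X ⊆ Y) :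
    G.stakeSum X ≤ G.stakeSum Y := by
  classical
  have h1 : G.stakeSum Y = G.stakeSum X + G.stakeSum (Y \ X) := by
    unfold stakeSum
    rw [← finsum_mem_union Set.disjoint_sdiff_right (Set.toFinite _) (Set.toFinite _),
      Set.union_sdiff_cancel h]
  have h2 : 0 ≤ G.stakeSum (Y \ X) :=
    finsum_nonneg fun v => finsum_nonneg fun _ => G.stake_nonneg v
  linarith

theorem stakeSum_nonneg (G : RestakingGraph) (X : Set G.V) : 0 ≤ G.stakeSum X :=
  finsum_nonneg fun v => finsum_nonneg fun _ => G.stake_nonneg v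

theorem stakeSum_union (G : RestakingGraph) {X Y : Set G.V} (h : Disjoint X Y) :
    G.stakeSum (X ∪ Y) = G.stakeSum X + G.stakeSum Y :=
  finsum_mem_union h (Set.toFinite _) (Set.toFinite _)

theorem cascade_coalition (G : RestakingGraph) (D : Set G.V) {T : ℕ} (A : Fin T → Set G.S)
    (B : Fin T → Set G.V) (hc : G.IsCascade D A B) :
    G.IsCoalition ∅ (⋃ t, A t) (D ∪ ⋃ t, B t) := by
  refine ⟨Set.disjoint_empty _, fun s hs => ?_⟩
  obtain ⟨t, ht⟩ := Set.mem_iUnion.1 hs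
  obtain ⟨⟨hd, hco⟩, -⟩ := hc.2.2 t
  have h1 := hco s ht
  set P := D ∪ G.prevUnion B t with hP
  have hPs : P ⊆ D ∪ ⋃ t, B t := by
    apply Set.union_subset_union_right
    intro v hv
    simp only [prevUnion, Set.mem_iUnion] at hv ⊢
    obtain ⟨i, -, hi⟩ := hv
    exact ⟨i, hi⟩
  have hBs : B t ⊆ D ∪ ⋃ t, B t :=
    (Set.subset_iUnion B t).trans Set.subset_union_right
  have e1 : G.stakeSum (G.Ns s \ ∅) = G.stakeSum (G.Ns s \ P) + G.stakeSum (P ∩ G.Ns s) := by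
    rw [← stakeSum_union]
    · congr 1
      ext v
      simp only [Set.mem_sdiff, Set.mem_union, Set.mem_inter_iff, Set.mem_empty_iff_false]
      by_cases hv : v ∈ P <;> simp [hv]
    · rw [Set.disjoint_left]
      rintro v ⟨_, h⟩ ⟨h', _⟩
      exact h h'
  have e2 : G.stakeSum (B t ∩ G.Ns s) + G.stakeSum (P ∩ G.Ns s)
      ≤ G.stakeSum ((D ∪ ⋃ t, B t) ∩ G.Ns s) := by
    rw [← stakeSum_union]
    · apply stakeSum_mono
      rintro v (⟨h, h'⟩ | ⟨h, h'⟩)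
      · exact ⟨hBs h, h'⟩
      · exact ⟨hPs h, h'⟩
    · exact hd.mono Set.inter_subset_left Set.inter_subset_left
  have e3 : G.alpha s * G.stakeSum (P ∩ G.Ns s) ≤ G.stakeSum (P ∩ G.Ns s) :=
    mul_le_of_le_one_left (G.stakeSum_nonneg _) (G.alpha_le_one s)
  rw [e1, mul_add]
  linarith

theorem cascade_bound (G : RestakingGraph) (γ : ℝ) (hγ : 0 < γ) (hslack : G.SecureWithSlack γ)
    (ψ : ℝ) (hψ : 0 < ψ) (D : Set G.V) {T : ℕ} (A : Fin T → Set G.S)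
    (B : Fin T → Set G.V) (hD : G.stakeSum D / G.totalStake ≤ ψ) (hc : G.IsCascade D A B) :
    G.stakeSum (⋃ t, B t) / G.totalStake < ψ / γ := by
  have hpos : 0 < ψ / γ := div_pos hψ hγ
  have hs := hslack _ _ (G.cascade_coalition D A B hc)
  have hA : G.piSum (⋃ t, A t) = ∑ t, G.piSum (A t) := by
    unfold piSum
    rw [finsum_mem_iUnion (fun i j h => hc.1 i j h) (fun _ => Set.toFinite _),
      finsum_eq_sum_of_fintype]
  have hB : G.stakeSum (⋃ t, B t) = ∑ t, G.stakeSum (B t) := by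
    unfold stakeSum
    rw [finsum_mem_iUnion (fun i j h => hc.2.1 i j h) (fun _ => Set.toFinite _),
      finsum_eq_sum_of_fintype]
  have hdisj : Disjoint D (⋃ t, B t) := by
    rw [Set.disjoint_iUnion_right]
    intro t
    exact ((hc.2.2 t).1.1.mono_right Set.subset_union_left).symm
  rw [stakeSum_union _ hdisj] at hs
  rcases (G.stakeSum_nonneg Set.univ).eq_or_lt with h0 | h0
  · have : G.totalStake = 0 := h0.symm
    rw [this, div_zero]
    exact hpos
  · have h0' : 0 < G.totalStake := h0
    rcases Nat.eq_zero_or_pos T with hT | hT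
    · subst hT
      rw [hB]
      simpa using hpos
    · have : Nonempty (Fin T) := ⟨⟨0, hT⟩⟩
      have hlt : G.stakeSum (⋃ t, B t) < G.piSum (⋃ t, A t) := by
        rw [hA, hB]
        exact Finset.sum_lt_sum_of_nonempty Finset.univ_nonempty fun t _ => (hc.2.2 t).2
      rw [div_le_iff₀ h0'] at hD
      rw [div_lt_div_iff₀ h0' hγ]
      have : (1 + γ) * G.stakeSum (⋃ t, B t) < (1 + γ) * G.piSum (⋃ t, A t) :=
        mul_lt_mul_of_pos_left hlt (by linarith)
      linarith

end RestakingGraph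

/-- Theorem: overcollateralization provides robust security.
If `G` is secure with `γ`-slack for some `γ > 0`, then for every `ψ > 0`,
`R_ψ(G) < (1 + 1/γ)·ψ`. -/
theorem overcollateralization_robust_security
    (G : RestakingGraph) (γ : ℝ) (hγ : 0 < γ) (hslack : G.SecureWithSlack γ)
    (ψ : ℝ) (hψ : 0 < ψ) :
    G.R ψ < (1 + 1 / γ) * ψ := by
  unfold RestakingGraph.R
  set X := { r : ℝ |
    ∃ (D : Set G.V) (T : ℕ) (A : Fin T → Set G.S) (B : Fin T → Set G.V),
      G.stakeSum D / G.totalStake ≤ ψ ∧ G.IsCascade D A B ∧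
      r = G.stakeSum (⋃ t, B t) / G.totalStake } with hX
  have hfin : X.Finite := by
    apply (Set.finite_range fun Y : Set G.V => G.stakeSum Y / G.totalStake).subset
    rintro r ⟨D, T, A, B, -, -, rfl⟩
    exact ⟨_, rfl⟩
  have hne : X.Nonempty := by
    refine ⟨_, ∅, 0, fun _ => ∅, fun _ => ∅, ?_, ⟨?_, ?_, ?_⟩, rfl⟩
    · simpa [RestakingGraph.stakeSum] using hψ.le
    · exact fun i => i.elim0
    · exact fun i => i.elim0
    · exact fun i => i.elim0
  obtain ⟨D, T, A, B, hD, hc, hr⟩ := hne.csSup_mem hfin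
  have h := G.cascade_bound γ hγ hslack ψ hψ D A B hD hc
  rw [← hr] at h
  have e : (1 + 1 / γ) * ψ = ψ + ψ / γ := by ring
  rw [e]
  linarith
end

section
/- For any ψ, γ, ε > 0 such that 0 ≤ (1 + 1/γ)·ψ − ε ≤ 1, there exists a restaking graph G that satisfies the γ-scaled EigenLayer condition (for each validator v, Σ_{s ∈ N(v)} (σ_v/σ_{N(s)})·((1+γ)·π_s/α_s) ≤ σ_v) but has R_ψ(G) ≥ (1 + 1/γ)·ψ − ε. -/
/-- One service; validators `0` (shocked), `1` (attacker), `2` (isolated). -/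
noncomputable def tightG (ψ γ b : ℝ) (hψ : 0 < ψ) (hγ : 0 < γ) (hb : 0 < b)
    (h1 : ψ + b ≤ 1) : RestakingGraph where
  S := Unit
  V := Fin 3
  finS := inferInstance
  finV := inferInstance
  E := fun _ v => v ≠ 2
  pi := fun _ => (ψ + b) / (1 + γ)
  stake := ![ψ, b, 1 - ψ - b]
  alpha := fun _ => 1
  pi_nonneg := fun _ => by positivity
  stake_nonneg := fun v => by
    fin_cases v
    · exact hψ.le
    · exact hb.le
    · show 0 ≤ 1 - ψ - b
      linarith
  alpha_pos := fun _ => one_pos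
  alpha_le_one := fun _ => le_rfl

open Classical in
theorem tightG_stakeSum (ψ γ b : ℝ) (hψ : 0 < ψ) (hγ : 0 < γ) (hb : 0 < b)
    (h1 : ψ + b ≤ 1) (B : Set (Fin 3)) :
    (tightG ψ γ b hψ hγ hb h1).stakeSum B =
      (if (0 : Fin 3) ∈ B then ψ else 0) + (if (1 : Fin 3) ∈ B then b else 0)
        + (if (2 : Fin 3) ∈ B then 1 - ψ - b else 0) := by
  have h : (tightG ψ γ b hψ hγ hb h1).stakeSum B
      = ∑ᶠ v ∈ B, (![ψ, b, 1 - ψ - b] : Fin 3 → ℝ) v := rfl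
  rw [h, finsum_mem_def, finsum_eq_sum_of_fintype, Fin.sum_univ_three]
  simp [Set.indicator]

theorem tightG_cond (ψ γ b : ℝ) (hψ : 0 < ψ) (hγ : 0 < γ) (hb : 0 < b)
    (h1 : ψ + b ≤ 1) : (tightG ψ γ b hψ hγ hb h1).EigenLayerSlackCond γ := by
  intro v
  have hs : ∀ s, (tightG ψ γ b hψ hγ hb h1).stakeSum ((tightG ψ γ b hψ hγ hb h1).Ns s)
      = ψ + b := by
    intro s
    refine (tightG_stakeSum ψ γ b hψ hγ hb h1 {v | v ≠ 2}).trans ?_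
    simp
  have hterm : ∀ s, (tightG ψ γ b hψ hγ hb h1).stake v /
      (tightG ψ γ b hψ hγ hb h1).stakeSum ((tightG ψ γ b hψ hγ hb h1).Ns s) *
      ((1 + γ) * (tightG ψ γ b hψ hγ hb h1).pi s / (tightG ψ γ b hψ hγ hb h1).alpha s)
      = (tightG ψ γ b hψ hγ hb h1).stake v := by
    intro s
    rw [hs]
    show _ / _ * ((1 + γ) * ((ψ + b) / (1 + γ)) / 1) = _
    have : ψ + b ≠ 0 := by positivity
    have : 1 + γ ≠ 0 := by positivity
    field_simp
  simp only [hterm]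
  have h0 := (tightG ψ γ b hψ hγ hb h1).stake_nonneg v
  generalize (tightG ψ γ b hψ hγ hb h1).stake v = x at h0
  generalize (tightG ψ γ b hψ hγ hb h1).Nv v = N
  change Set Unit at N
  show ∑ᶠ s ∈ (N : Set Unit), x ≤ x
  rw [finsum_mem_def, finsum_eq_sum_of_fintype]
  simp only [Finset.univ_unique, Finset.sum_singleton]
  exact Set.indicator_le_self' (fun _ _ => h0) _

theorem RestakingGraph.R_bdd (G : RestakingGraph) (ψ : ℝ) : BddAbove { r : ℝ |
    ∃ (D : Set G.V) (T : ℕ) (A : Fin T → Set G.S) (B : Fin T → Set G.V),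
      G.stakeSum D / G.totalStake ≤ ψ ∧ G.IsCascade D A B ∧
      r = G.stakeSum (⋃ t, B t) / G.totalStake } := by
  apply Set.Finite.bddAbove
  apply (Set.finite_range (fun U : Set G.V => G.stakeSum U / G.totalStake)).subset
  rintro r ⟨D, T, A, B, -, -, rfl⟩
  exact ⟨_, rfl⟩

theorem RestakingGraph.R_ge (G : RestakingGraph) (ψ : ℝ) : ψ ≤ G.R ψ := by
  have hn : ∀ U, 0 ≤ G.stakeSum U := fun U =>
    finsum_nonneg fun v => finsum_nonneg fun _ => G.stake_nonneg v
  refine le_add_of_nonneg_right (Real.sSup_nonneg ?_)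
  rintro r ⟨D, T, A, B, -, -, rfl⟩
  exact div_nonneg (hn _) (hn _)

theorem RestakingGraph.R_single (G : RestakingGraph) (ψ : ℝ) (D : Set G.V) (A : Set G.S)
    (B : Set G.V) (hD : G.stakeSum D / G.totalStake ≤ ψ) (h : G.IsValidAttack D A B) :
    ψ + G.stakeSum B / G.totalStake ≤ G.R ψ := by
  refine add_le_add_right (le_csSup (RestakingGraph.R_bdd G ψ) ?_) ψ
  refine ⟨D, 1, fun _ => A, fun _ => B, hD, ⟨?_, ?_, ?_⟩, ?_⟩
  · intro i j h; exact absurd (Subsingleton.elim i j) h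
  · intro i j h; exact absurd (Subsingleton.elim i j) h
  · intro t
    have hp : G.prevUnion (fun _ : Fin 1 => B) t = ∅ := by
      refine Set.eq_empty_of_forall_notMem fun x hx => ?_
      obtain ⟨i, hi⟩ := Set.mem_iUnion.1 hx
      obtain ⟨hlt, -⟩ := Set.mem_iUnion.1 hi
      exact hlt.ne (Subsingleton.elim i t)
    rw [hp, Set.union_empty]
    exact h
  · rw [Set.iUnion_const]

theorem tightG_R (ψ γ b : ℝ) (hψ : 0 < ψ) (hγ : 0 < γ) (hb : 0 < b)
    (h1 : ψ + b ≤ 1) (hlt : γ * b < ψ) : ψ + b ≤ (tightG ψ γ b hψ hγ hb h1).R ψ := by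
  have hS := tightG_stakeSum ψ γ b hψ hγ hb h1
  have ht : (tightG ψ γ b hψ hγ hb h1).totalStake = 1 := by
    refine (hS Set.univ).trans ?_
    simp
  have hB : (tightG ψ γ b hψ hγ hb h1).stakeSum ({1} : Set (Fin 3)) = b := by
    refine (hS {1}).trans ?_
    simp
  have hD : (tightG ψ γ b hψ hγ hb h1).stakeSum ({0} : Set (Fin 3)) = ψ := by
    refine (hS {0}).trans ?_
    simp
  have key := (tightG ψ γ b hψ hγ hb h1).R_single ψ ({0} : Set (Fin 3)) Set.univ
    ({1} : Set (Fin 3))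
  rw [hB, hD, ht, div_one, div_one] at key
  refine key le_rfl ⟨⟨?_, ?_⟩, ?_⟩
  · exact Set.disjoint_singleton.2 (by decide : (1 : Fin 3) ≠ 0)
  · intro s _
    have e1 : (tightG ψ γ b hψ hγ hb h1).stakeSum
        (({v | v ≠ 2} \ {0} : Set (Fin 3))) = b := by
      refine (hS ({v | v ≠ 2} \ {0})).trans ?_
      simp
    have e2 : (tightG ψ γ b hψ hγ hb h1).stakeSum
        (({1} ∩ {v | v ≠ 2} : Set (Fin 3))) = b := by
      refine (hS ({1} ∩ {v | v ≠ 2})).trans ?_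
      simp
    exact ((one_mul _).trans (e1.trans e2.symm)).le
  · rw [hB]
    have : (tightG ψ γ b hψ hγ hb h1).piSum Set.univ = (ψ + b) / (1 + γ) := by
      show ∑ᶠ s ∈ (Set.univ : Set Unit), (ψ + b) / (1 + γ) = _
      rw [finsum_mem_def, finsum_eq_sum_of_fintype]
      simp
    rw [this, lt_div_iff₀ (by positivity)]
    linarith

/-- Theorem: the robust security bound is tight.
For any `ψ, γ, ε > 0` with `0 ≤ (1 + 1/γ)·ψ − ε ≤ 1`, there is a restaking
graph satisfying the `γ`-scaled EigenLayer condition but with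
`R_ψ(G) ≥ (1 + 1/γ)·ψ − ε`. -/
theorem slack_bound_tight (ψ γ ε : ℝ) (hψ : 0 < ψ) (hγ : 0 < γ) (hε : 0 < ε)
    (hlo : 0 ≤ (1 + 1 / γ) * ψ - ε) (hhi : (1 + 1 / γ) * ψ - ε ≤ 1) :
    ∃ G : RestakingGraph, G.EigenLayerSlackCond γ ∧
      (1 + 1 / γ) * ψ - ε ≤ G.R ψ := by
  have e : (1 + 1 / γ) * ψ - ε = ψ + (ψ / γ - ε) := by ring
  rw [e] at hhi ⊢
  rcases lt_or_ge 0 (ψ / γ - ε) with hb | hb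
  · refine ⟨tightG ψ γ _ hψ hγ hb hhi, tightG_cond ψ γ _ hψ hγ hb hhi, tightG_R ψ γ _ hψ hγ hb hhi ?_⟩
    have : γ * (ψ / γ - ε) = ψ - γ * ε := by field_simp
    have := mul_pos hγ hε
    linarith
  · refine ⟨⟨Empty, Empty, inferInstance, inferInstance, fun _ _ => True, fun _ => 0,
      fun _ => 0, fun _ => 1, fun _ => le_rfl, fun _ => le_rfl, fun _ => one_pos,
      fun _ => le_rfl⟩, fun v => Empty.elim v, ?_⟩
    exact le_trans (by linarith) (RestakingGraph.R_ge _ ψ)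
end
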